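/- (Converse part of the covariant-memory-cell capacity theorem.) Let G be a finite group, d ≥ 1, and let U : G → (d×d unitary matrices) satisfy: (i) multiplicativity as channels, i.e., for all g,h ∈ G and all d×d matrices X, U(g)U(h)·X·U(h)†U(g)† = U(gh)·X·U(gh)†; and (ii) the unitary one-design property, i.e., for all d×d matrices X, (1/|G|)·∑_{g∈G} U(g) X U(g)† = (Tr X / d)·I_d. Let N be a trace-preserving Kraus channel from ℂ^d to ℂ^{d'}, and let V : G → (d'×d' unitary matrices) satisfy the covariance condition N(U(g) X U(g)†) = V(g) N(X) V(g)† for all g ∈ G and all d×d matrices X. For g ∈ G define ω^g := (id_d ⊗ N)((I_d⊗U(g)) Φ_d (I_d⊗U(g))†). Then for every probability distribution p on G: H(∑_{g∈G} p(g) ω^g) − ∑_{g∈G} p(g) H(ω^g) ≤ log₂ d + H(N(I_d/d)) − H((id_d⊗N)(Φ_d)). -/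

import Mathlib

open Matrix Kronecker BigOperators ComplexOrder

/-- von Neumann entropy (base 2) of a matrix, via its eigenvalues when Hermitian. -/
noncomputable def vnEntropy {n : Type*} [Fintype n] [DecidableEq n] (ρ : Matrix n n ℂ) : ℝ :=
  if h : ρ.IsHermitian then -∑ i, (h.eigenvalues i) * Real.logb 2 (h.eigenvalues i) else 0

/-- Application of a map given by a Kraus family. -/
noncomputable def krausApply {a b ι : Type*} [Fintype a] [Fintype b] [Fintype ι]
    (K : ι → Matrix b a ℂ) (X : Matrix a a ℂ) : Matrix b b ℂ :=
  ∑ j, K j * X * (K j)ᴴ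

/-- Application of `id ⊗ (Kraus channel)`, acting on the second tensor factor. -/
noncomputable def idTensorApply {r a b ι : Type*} [Fintype r] [DecidableEq r]
    [Fintype a] [Fintype b] [Fintype ι]
    (K : ι → Matrix b a ℂ) (X : Matrix (r × a) (r × a) ℂ) : Matrix (r × b) (r × b) ℂ :=
  ∑ j, ((1 : Matrix r r ℂ) ⊗ₖ K j) * X * ((1 : Matrix r r ℂ) ⊗ₖ K j)ᴴ

/-- The maximally entangled state `Φ_d` on `ℂ^d ⊗ ℂ^d`. -/
noncomputable def maxEnt (d : ℕ) : Matrix (Fin d × Fin d) (Fin d × Fin d) ℂ :=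
  Matrix.of (fun p q => if p.1 = p.2 ∧ q.1 = q.2 then (d : ℂ)⁻¹ else 0)

/-- The state `ω^g = (id ⊗ N)((1 ⊗ U(g)) Φ_d (1 ⊗ U(g))†)`. -/
noncomputable def omegaG {G : Type} {d d' kN : ℕ}
    (U : G → Matrix (Fin d) (Fin d) ℂ) (KN : Fin kN → Matrix (Fin d') (Fin d) ℂ)
    (g : G) : Matrix (Fin d × Fin d') (Fin d × Fin d') ℂ :=
  idTensorApply KN
    ((((1 : Matrix (Fin d) (Fin d) ℂ) ⊗ₖ U g)) * maxEnt d *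
      (((1 : Matrix (Fin d) (Fin d) ℂ) ⊗ₖ U g))ᴴ)

theorem vnEntropy_eq_sum_negMulLog {n : Type*} [Fintype n] [DecidableEq n] {A : Matrix n n ℂ}
    (hA : A.IsHermitian) :
    vnEntropy A = (∑ i, Real.negMulLog (hA.eigenvalues i)) / Real.log 2 := by
  rw [vnEntropy, dif_pos hA, Finset.sum_div, ← Finset.sum_neg_distrib]
  refine Finset.sum_congr rfl fun i _ => ?_
  rw [Real.negMulLog, Real.logb]
  ring

/-- The von Neumann entropy is invariant under conjugation by a unitary. -/
theorem vnEntropy_unitary_conj {n : Type*} [Fintype n] [DecidableEq n] {A Q : Matrix n n ℂ}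
    (hA : A.IsHermitian) (hQ : Qᴴ * Q = 1) : vnEntropy (Q * A * Qᴴ) = vnEntropy A := by
  have hB : (Q * A * Qᴴ).IsHermitian := isHermitian_mul_mul_conjTranspose Q hA
  have hchar : (Q * A * Qᴴ).charpoly = A.charpoly := by
    rw [charpoly_mul_comm, ← mul_assoc, hQ, one_mul]
  rw [vnEntropy_eq_sum_negMulLog hA, vnEntropy_eq_sum_negMulLog hB,
    (hB.eigenvalues_eq_eigenvalues_iff hA).2 hchar]

theorem Matrix.IsHermitian.re_diag_eq_sum {n : Type*} [Fintype n] [DecidableEq n]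
    {A : Matrix n n ℂ} (hA : A.IsHermitian) (i : n) :
    (A i i).re =
      ∑ k, Complex.normSq ((hA.eigenvectorUnitary : Matrix n n ℂ) i k) * hA.eigenvalues k := by
  conv_lhs => rw [hA.spectral_theorem, Unitary.conjStarAlgAut_apply]
  rw [mul_apply, Complex.re_sum]
  refine Finset.sum_congr rfl fun k _ => ?_
  rw [mul_diagonal, star_apply]
  simp only [Function.comp_apply, Complex.coe_algebraMap, RCLike.star_def]
  rw [mul_right_comm, Complex.mul_conj]
  norm_cast

/-- The entropy of a positive semidefinite matrix is at most the entropy of its diagonal. -/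
theorem vnEntropy_le_sum_negMulLog_diag {n : Type*} [Fintype n] [DecidableEq n]
    {A : Matrix n n ℂ} (hA : A.PosSemidef) :
    vnEntropy A ≤ (∑ i, Real.negMulLog (A i i).re) / Real.log 2 := by
  have hH := hA.isHermitian
  rw [vnEntropy_eq_sum_negMulLog hH]
  refine div_le_div_of_nonneg_right ?_ (Real.log_nonneg one_le_two)
  set Q : Matrix n n ℂ := hH.eigenvectorUnitary.1
  have hrow : ∀ i, ∑ k, Complex.normSq (Q i k) = 1 := by
    intro i
    have h : (Q * star Q) i i = (1 : Matrix n n ℂ) i i :=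
      congrFun (congrFun (Unitary.coe_mul_star_self hH.eigenvectorUnitary) i) i
    rw [mul_apply, one_apply_eq] at h
    simp only [star_apply, RCLike.star_def, Complex.mul_conj] at h
    exact_mod_cast h
  have hcol : ∀ k, ∑ i, Complex.normSq (Q i k) = 1 := by
    intro k
    have h : (star Q * Q) k k = (1 : Matrix n n ℂ) k k :=
      congrFun (congrFun (Unitary.coe_star_mul_self hH.eigenvectorUnitary) k) k
    rw [mul_apply, one_apply_eq] at h
    simp only [star_apply, RCLike.star_def, mul_comm _ (Q _ _), Complex.mul_conj] at h
    exact_mod_cast h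
  calc ∑ k, Real.negMulLog (hH.eigenvalues k)
      = ∑ i, ∑ k, Complex.normSq (Q i k) * Real.negMulLog (hH.eigenvalues k) := by
        rw [Finset.sum_comm]
        simp_rw [← Finset.sum_mul, hcol, one_mul]
    _ ≤ ∑ i, Real.negMulLog (A i i).re := by
        refine Finset.sum_le_sum fun i _ => ?_
        rw [hH.re_diag_eq_sum i]
        simpa only [smul_eq_mul] using Real.concaveOn_negMulLog.le_map_sum (t := Finset.univ)
          (w := fun k => Complex.normSq (Q i k)) (p := hH.eigenvalues)
          (fun k _ => Complex.normSq_nonneg _) (hrow i)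
          (fun k _ => hA.eigenvalues_nonneg k)

theorem sum_negMulLog_le {r : Type*} [Fintype r] [Nonempty r] {s : r → ℝ} (hs : ∀ i, 0 ≤ s i) :
    ∑ i, Real.negMulLog (s i) ≤
      Real.negMulLog (∑ i, s i) + (∑ i, s i) * Real.log (Fintype.card r) := by
  have hc : (0 : ℝ) < Fintype.card r := by exact_mod_cast Fintype.card_pos
  have h := Real.concaveOn_negMulLog.le_map_sum (t := Finset.univ)
    (w := fun _ : r => (Fintype.card r : ℝ)⁻¹) (p := s) (fun _ _ => by positivity)
    (by simp [hc.ne']) (fun i _ => hs i)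
  simp only [smul_eq_mul, ← Finset.mul_sum] at h
  have h2 := mul_le_mul_of_nonneg_left h hc.le
  rw [mul_inv_cancel_left₀ hc.ne', Real.negMulLog_mul] at h2
  refine h2.trans_eq ?_
  simp only [Real.negMulLog, Real.log_inv]
  field_simp
  ring

theorem ext_submatrix {r a : Type*} {X Y : Matrix (r × a) (r × a) ℂ}
    (h : ∀ i j, X.submatrix (Prod.mk i) (Prod.mk j) = Y.submatrix (Prod.mk i) (Prod.mk j)) :
    X = Y := by
  ext ⟨i, x⟩ ⟨j, y⟩
  exact congrFun (congrFun (h i j) x) y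

section Blocks

variable {r a b : Type*} [Fintype r] [DecidableEq r] [Fintype a]

theorem one_kronecker_conj_submatrix (A : Matrix b a ℂ) (X : Matrix (r × a) (r × a) ℂ) (i j : r) :
    (((1 : Matrix r r ℂ) ⊗ₖ A) * X * ((1 : Matrix r r ℂ) ⊗ₖ A)ᴴ).submatrix
      (Prod.mk i) (Prod.mk j) = A * X.submatrix (Prod.mk i) (Prod.mk j) * Aᴴ := by
  ext x y
  simp [mul_apply, Fintype.sum_prod_type, kroneckerMap_apply, one_apply, apply_ite, ite_mul,
    Finset.sum_ite_irrel]

theorem idTensorApply_submatrix {ι : Type*} [Fintype ι] [Fintype b] (K : ι → Matrix b a ℂ)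
    (X : Matrix (r × a) (r × a) ℂ) (i j : r) :
    (idTensorApply K X).submatrix (Prod.mk i) (Prod.mk j) =
      krausApply K (X.submatrix (Prod.mk i) (Prod.mk j)) := by
  simp only [krausApply, ← one_kronecker_conj_submatrix]
  ext x y
  simp [idTensorApply, Matrix.sum_apply]

theorem Matrix.PosSemidef.idTensorApply {ι : Type*} [Fintype ι] [Fintype b]
    {X : Matrix (r × a) (r × a) ℂ} (hX : X.PosSemidef) (K : ι → Matrix b a ℂ) :
    (idTensorApply K X).PosSemidef :=
  posSemidef_sum _ fun _ _ => hX.mul_mul_conjTranspose_same _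

end Blocks

theorem trace_krausApply {a b ι : Type*} [Fintype a] [DecidableEq a] [Fintype b] [Fintype ι]
    {K : ι → Matrix b a ℂ} (hK : ∑ j, (K j)ᴴ * K j = 1) (X : Matrix a a ℂ) :
    (krausApply K X).trace = X.trace := by
  rw [krausApply, trace_sum]
  calc ∑ j, (K j * X * (K j)ᴴ).trace = ∑ j, ((K j)ᴴ * K j * X).trace :=
        Finset.sum_congr rfl fun j _ => by rw [trace_mul_comm, Matrix.mul_assoc]
    _ = X.trace := by rw [← trace_sum, ← Finset.sum_mul, hK, one_mul]

/-- A weak form of subadditivity of the entropy: the first marginal contributes at most the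
logarithm of its dimension. -/
theorem vnEntropy_le_logb_card_add {r b : Type*} [Fintype r] [DecidableEq r] [Nonempty r]
    [Fintype b] [DecidableEq b] {σ : Matrix (r × b) (r × b) ℂ} (hσ : σ.PosSemidef)
    {τ : Matrix b b ℂ} (hτ : ∑ i, σ.submatrix (Prod.mk i) (Prod.mk i) = τ) (htr : τ.trace = 1) :
    vnEntropy σ ≤ Real.logb 2 (Fintype.card r) + vnEntropy τ := by
  have hτH : τ.IsHermitian := by
    rw [← hτ]
    exact (posSemidef_sum _ fun i _ => hσ.submatrix _).isHermitian
  set W : Matrix b b ℂ := hτH.eigenvectorUnitary.1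
  have hWW : W * Wᴴ = 1 := Unitary.coe_mul_star_self hτH.eigenvectorUnitary
  set Q : Matrix (r × b) (r × b) ℂ := (1 : Matrix r r ℂ) ⊗ₖ Wᴴ with hQ
  have hQQ : Qᴴ * Q = 1 := by
    rw [hQ, conjTranspose_kronecker, conjTranspose_conjTranspose, ← mul_kronecker_mul, hWW]
    simp
  have hB : (Q * σ * Qᴴ).PosSemidef := hσ.mul_mul_conjTranspose_same Q
  have hmarg : ∀ j, ∑ i, ((Q * σ * Qᴴ) (i, j) (i, j)).re = hτH.eigenvalues j := by
    intro j
    have h1 : ∑ i, (Q * σ * Qᴴ).submatrix (Prod.mk i) (Prod.mk i) =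
        diagonal (RCLike.ofReal ∘ hτH.eigenvalues) := by
      simp_rw [hQ, one_kronecker_conj_submatrix, ← Finset.sum_mul, ← Finset.mul_sum, hτ]
      rw [← hτH.conjStarAlgAut_star_eigenvectorUnitary, Unitary.conjStarAlgAut_apply]
      rfl
    have h2 := congrArg Complex.re (congrFun (congrFun h1 j) j)
    simpa [Matrix.sum_apply] using h2
  have htr' : ∑ j, hτH.eigenvalues j = 1 := by
    have h := hτH.trace_eq_sum_eigenvalues
    rw [htr] at h
    exact Complex.ofReal_injective (by simpa using h.symm)
  have hnn : ∀ x, 0 ≤ ((Q * σ * Qᴴ) x x).re := fun x => (Complex.le_def.1 hB.diag_nonneg).1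
  rw [← vnEntropy_unitary_conj hσ.isHermitian hQQ]
  refine (vnEntropy_le_sum_negMulLog_diag hB).trans ?_
  rw [vnEntropy_eq_sum_negMulLog hτH, Real.logb, ← add_div]
  refine div_le_div_of_nonneg_right ?_ (Real.log_nonneg one_le_two)
  rw [Fintype.sum_prod_type_right]
  calc _ ≤ ∑ j, (Real.negMulLog (hτH.eigenvalues j) +
          hτH.eigenvalues j * Real.log (Fintype.card r)) := by
        refine Finset.sum_le_sum fun j _ => ?_
        rw [← hmarg j]
        exact sum_negMulLog_le fun i => hnn (i, j)
    _ = _ := by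
        rw [Finset.sum_add_distrib, ← Finset.sum_mul, htr', one_mul, add_comm]

theorem posSemidef_maxEnt (d : ℕ) : (maxEnt d).PosSemidef := by
  have h : maxEnt d = (d : ℂ)⁻¹ • vecMulVec (fun p : Fin d × Fin d => if p.1 = p.2 then (1 : ℂ)
      else 0) (star fun p : Fin d × Fin d => if p.1 = p.2 then (1 : ℂ) else 0) := by
    ext p q
    by_cases h1 : p.1 = p.2 <;> by_cases h2 : q.1 = q.2 <;> simp [maxEnt, vecMulVec, h1, h2]
  rw [h]
  exact (posSemidef_vecMulVec_self_star _).smul (by positivity)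

theorem sum_maxEnt_submatrix (d : ℕ) :
    ∑ i, (maxEnt d).submatrix (Prod.mk i) (Prod.mk i) = (d : ℂ)⁻¹ • 1 := by
  ext x y
  simp [maxEnt, Matrix.sum_apply, one_apply, ite_and, eq_comm]

theorem krausApply_sum {a b ι κ : Type*} [Fintype a] [Fintype b] [Fintype ι]
    (K : ι → Matrix b a ℂ) (s : Finset κ) (X : κ → Matrix a a ℂ) :
    krausApply K (∑ k ∈ s, X k) = ∑ k ∈ s, krausApply K (X k) := by
  simp only [krausApply, Matrix.mul_sum, Matrix.sum_mul]
  exact Finset.sum_comm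

/-- **Converse part of the covariant-memory-cell capacity theorem.**
For a covariant channel `N` (with respect to a one-design `U`), the Holevo-like quantity of the
ensemble `{p(g), ω^g}` is bounded by the entanglement-assisted mutual information
`log₂ d + H(N(I/d)) − H((id⊗N)(Φ_d))`. -/
theorem covariant_memory_cell_converse
    {G : Type} [Fintype G] [Group G]
    {d d' : ℕ} (hd : 1 ≤ d)
    (U : G → Matrix (Fin d) (Fin d) ℂ)
    (hUunitary : ∀ g, U g * (U g)ᴴ = 1 ∧ (U g)ᴴ * U g = 1)
    (hUmul : ∀ (g h : G) (X : Matrix (Fin d) (Fin d) ℂ),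
      U g * (U h * X * (U h)ᴴ) * (U g)ᴴ = U (g * h) * X * (U (g * h))ᴴ)
    (hUdesign : ∀ X : Matrix (Fin d) (Fin d) ℂ,
      (1 / (Fintype.card G : ℂ)) • ∑ g, U g * X * (U g)ᴴ = (X.trace / (d : ℂ)) • 1)
    (kN : ℕ) (KN : Fin kN → Matrix (Fin d') (Fin d) ℂ)
    (hKN : ∑ j, (KN j)ᴴ * KN j = 1)
    (V : G → Matrix (Fin d') (Fin d') ℂ)
    (hVunitary : ∀ g, V g * (V g)ᴴ = 1 ∧ (V g)ᴴ * V g = 1)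
    (hcov : ∀ (g : G) (X : Matrix (Fin d) (Fin d) ℂ),
      krausApply KN (U g * X * (U g)ᴴ) = V g * krausApply KN X * (V g)ᴴ)
    (p : G → ℝ) (hp : ∀ g, 0 ≤ p g) (hp1 : ∑ g, p g = 1) :
    vnEntropy (∑ g, (p g : ℂ) • omegaG U KN g) - ∑ g, p g * vnEntropy (omegaG U KN g) ≤
      Real.logb 2 d + vnEntropy (krausApply KN ((d : ℂ)⁻¹ • 1)) -
        vnEntropy (idTensorApply KN (maxEnt d)) := by
  have : Nonempty (Fin d) := ⟨⟨0, hd⟩⟩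
  have hd0 : (d : ℂ) ≠ 0 := by exact_mod_cast (by omega : d ≠ 0)
  have hψ := (posSemidef_maxEnt d).idTensorApply KN
  have hω : ∀ g, (omegaG U KN g).PosSemidef := fun g =>
    ((posSemidef_maxEnt d).mul_mul_conjTranspose_same _).idTensorApply KN
  have hconj : ∀ g, omegaG U KN g = ((1 : Matrix (Fin d) (Fin d) ℂ) ⊗ₖ V g) *
      idTensorApply KN (maxEnt d) * ((1 : Matrix (Fin d) (Fin d) ℂ) ⊗ₖ V g)ᴴ := by
    intro g
    refine ext_submatrix fun i j => ?_
    rw [omegaG, idTensorApply_submatrix, one_kronecker_conj_submatrix, hcov,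
      one_kronecker_conj_submatrix, idTensorApply_submatrix]
  have hent : ∀ g, vnEntropy (omegaG U KN g) = vnEntropy (idTensorApply KN (maxEnt d)) := by
    intro g
    rw [hconj]
    refine vnEntropy_unitary_conj hψ.isHermitian ?_
    rw [conjTranspose_kronecker, ← mul_kronecker_mul, (hVunitary g).2]
    simp
  have hmarg : ∀ g, ∑ i, (omegaG U KN g).submatrix (Prod.mk i) (Prod.mk i) =
      krausApply KN ((d : ℂ)⁻¹ • 1) := by
    intro g
    simp_rw [omegaG, idTensorApply_submatrix, one_kronecker_conj_submatrix]
    rw [← krausApply_sum, ← Finset.sum_mul, ← Finset.mul_sum, sum_maxEnt_submatrix]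
    simp [(hUunitary g).1]
  have hσ : (∑ g, (p g : ℂ) • omegaG U KN g).PosSemidef :=
    posSemidef_sum _ fun g _ => (hω g).smul (by exact_mod_cast hp g)
  have hσmarg : ∑ i, (∑ g, (p g : ℂ) • omegaG U KN g).submatrix (Prod.mk i) (Prod.mk i) =
      krausApply KN ((d : ℂ)⁻¹ • 1) := by
    have hp1' : ∑ g, (p g : ℂ) = 1 := by exact_mod_cast hp1
    calc _ = ∑ g, (p g : ℂ) • ∑ i, (omegaG U KN g).submatrix (Prod.mk i) (Prod.mk i) := by
          simp_rw [Finset.smul_sum]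
          rw [Finset.sum_comm]
          ext x y
          simp [Matrix.sum_apply]
      _ = _ := by simp_rw [hmarg, ← Finset.sum_smul, hp1', one_smul]
  have hsub := vnEntropy_le_logb_card_add hσ hσmarg
    (by rw [trace_krausApply hKN]; simp [hd0])
  rw [Fintype.card_fin] at hsub
  simp_rw [hent, ← Finset.sum_mul, hp1, one_mul]
  linarith
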